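/- Let (T(t))_{t≥0} be a bounded C₀-semigroup on a reflexive Banach space X, with generator A. If the intersection of the spectrum σ(A) with the imaginary axis iℝ is countable and no eigenvalue of A lies on the imaginary axis, then T(t)x → 0 as t → +∞ for every x ∈ X. -/

import Mathlib

open MeasureTheory Set Filter
open scoped Topology

noncomputable section

/-- The Laplace transform of `h : ℝ → ℂ`, restricted to the half-line `t > 0`. -/
def laplaceTransform (h : ℝ → ℂ) (z : ℂ) : ℂ :=
  ∫ t in Ioi (0 : ℝ), Complex.exp (-z * t) * h t

section Laplace

variable {h k : ℝ → ℂ} {M : ℝ} {z : ℂ}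

lemma norm_cexp_neg_mul_ofReal (z : ℂ) (t : ℝ) :
    ‖Complex.exp (-z * t)‖ = Real.exp (-z.re * t) := by
  simp [Complex.norm_exp]

lemma aestronglyMeasurable_laplace (hc : ContinuousOn h (Ici 0)) (z : ℂ) :
    AEStronglyMeasurable (fun t : ℝ => Complex.exp (-z * t) * h t)
      (volume.restrict (Ioi 0)) := by
  refine ContinuousOn.aestronglyMeasurable ?_ measurableSet_Ioi
  exact ContinuousOn.mul (by fun_prop) (hc.mono Ioi_subset_Ici_self)

lemma norm_laplace_integrand_le (hb : ∀ t, 0 ≤ t → ‖h t‖ ≤ M) (z : ℂ) {t : ℝ} (ht : 0 ≤ t) :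
    ‖Complex.exp (-z * t) * h t‖ ≤ Real.exp (-z.re * t) * M := by
  rw [norm_mul, norm_cexp_neg_mul_ofReal]
  exact mul_le_mul_of_nonneg_left (hb t ht) (Real.exp_nonneg _)

lemma integrableOn_laplace (hc : ContinuousOn h (Ici 0)) (hb : ∀ t, 0 ≤ t → ‖h t‖ ≤ M)
    (hz : 0 < z.re) :
    IntegrableOn (fun t : ℝ => Complex.exp (-z * t) * h t) (Ioi 0) := by
  refine Integrable.mono' ((exp_neg_integrableOn_Ioi 0 hz).mul_const M)
    (aestronglyMeasurable_laplace hc z) ?_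
  filter_upwards [ae_restrict_mem measurableSet_Ioi] with t ht
  exact norm_laplace_integrand_le hb z (le_of_lt ht)

lemma norm_laplaceTransform_le (hb : ∀ t, 0 ≤ t → ‖h t‖ ≤ M) (hz : 0 < z.re) :
    ‖laplaceTransform h z‖ ≤ M / z.re := by
  have h1 : ‖laplaceTransform h z‖ ≤ ∫ t in Ioi (0 : ℝ), Real.exp (-z.re * t) * M := by
    refine norm_integral_le_of_norm_le ((exp_neg_integrableOn_Ioi 0 hz).mul_const M) ?_
    filter_upwards [ae_restrict_mem measurableSet_Ioi] with t ht
    exact norm_laplace_integrand_le hb z (le_of_lt ht)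
  rw [integral_mul_const, integral_exp_mul_Ioi (by linarith)] at h1
  simpa [div_eq_inv_mul] using h1

lemma laplaceTransform_add (hc : ContinuousOn h (Ici 0)) (hb : ∀ t, 0 ≤ t → ‖h t‖ ≤ M)
    {M' : ℝ} (kc : ContinuousOn k (Ici 0)) (kb : ∀ t, 0 ≤ t → ‖k t‖ ≤ M') (hz : 0 < z.re) :
    laplaceTransform (fun t => h t + k t) z = laplaceTransform h z + laplaceTransform k z := by
  simp only [laplaceTransform, mul_add]
  exact integral_add (integrableOn_laplace hc hb hz) (integrableOn_laplace kc kb hz)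

lemma laplaceTransform_const_mul (c : ℂ) (h : ℝ → ℂ) (z : ℂ) :
    laplaceTransform (fun t => c * h t) z = c * laplaceTransform h z := by
  simp only [laplaceTransform, mul_left_comm _ c]
  exact integral_const_mul _ _

lemma differentiableAt_laplaceTransform (hc : ContinuousOn h (Ici 0))
    (hb : ∀ t, 0 ≤ t → ‖h t‖ ≤ M) (hz : 0 < z.re) :
    DifferentiableAt ℂ (laplaceTransform h) z := by
  have hs : {w : ℂ | z.re / 2 < w.re} ∈ 𝓝 z :=
    (isOpen_lt continuous_const Complex.continuous_re).mem_nhds (by simp; linarith)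
  have hint : IntegrableOn (fun t : ℝ => t ^ (1 : ℝ) * Real.exp (-(z.re / 2) * t ^ (1 : ℝ)) * M)
      (Ioi 0) :=
    (integrableOn_rpow_mul_exp_neg_mul_rpow (by norm_num) one_pos (half_pos hz)).mul_const M
  refine (hasDerivAt_integral_of_dominated_loc_of_deriv_le (μ := volume.restrict (Ioi (0 : ℝ)))
    (F := fun w t => Complex.exp (-w * (t : ℝ)) * h t)
    (F' := fun w t => -(t : ℂ) * Complex.exp (-w * (t : ℝ)) * h t) hs
    (Eventually.of_forall fun w => aestronglyMeasurable_laplace hc w)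
    (integrableOn_laplace hc hb hz) ?_ ?_ hint ?_).2.differentiableAt
  · refine ContinuousOn.aestronglyMeasurable ?_ measurableSet_Ioi
    exact ContinuousOn.mul (by fun_prop) (hc.mono Ioi_subset_Ici_self)
  · filter_upwards [ae_restrict_mem measurableSet_Ioi] with t ht w hw
    have ht' : (0 : ℝ) < t := ht
    have hw' : z.re / 2 < w.re := hw
    have h1 : ‖-(t : ℂ) * Complex.exp (-w * t) * h t‖ = t * ‖Complex.exp (-w * t) * h t‖ := by
      rw [mul_assoc, norm_mul, norm_neg, Complex.norm_real, Real.norm_of_nonneg ht'.le]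
    have h2 : Real.exp (-w.re * t) ≤ Real.exp (-(z.re / 2) * t) :=
      Real.exp_le_exp.2 (by nlinarith)
    have hM : 0 ≤ M := (norm_nonneg _).trans (hb t ht'.le)
    rw [h1, Real.rpow_one, mul_assoc]
    refine mul_le_mul_of_nonneg_left ?_ ht'.le
    exact (norm_laplace_integrand_le hb w ht'.le).trans (mul_le_mul_of_nonneg_right h2 hM)
  · filter_upwards with t w _
    have h1 : HasDerivAt (fun w : ℂ => -w * (t : ℂ)) (-1 * (t : ℂ)) w :=
      (hasDerivAt_id w).neg.mul_const _
    exact (h1.cexp.mul_const (h t)).congr_deriv (by ring)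

lemma laplaceTransform_comp_add (hc : ContinuousOn h (Ici 0)) (hb : ∀ t, 0 ≤ t → ‖h t‖ ≤ M)
    (hz : 0 < z.re) {s : ℝ} (hs : 0 ≤ s) :
    laplaceTransform (fun t => h (t + s)) z =
      Complex.exp (z * s) *
        (laplaceTransform h z - ∫ t in (0 : ℝ)..s, Complex.exp (-z * t) * h t) := by
  have h0 := integrableOn_laplace hc hb hz
  have h1 := intervalIntegral.integral_interval_add_Ioi h0 (h0.mono_set (Ioi_subset_Ioi hs))
  have h2 : ∫ t in Ioi (0 : ℝ), Complex.exp (-z * ((t + s : ℝ) : ℂ)) * h (t + s) =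
      ∫ t in Ioi s, Complex.exp (-z * t) * h t := by
    have := (measurePreserving_add_right (volume : Measure ℝ) s).setIntegral_preimage_emb
      (measurableEmbedding_addRight s) (fun t : ℝ => Complex.exp (-z * t) * h t) (Ioi s)
    simpa using this
  have h3 : laplaceTransform h z - ∫ t in (0 : ℝ)..s, Complex.exp (-z * t) * h t =
      ∫ t in Ioi s, Complex.exp (-z * t) * h t := by
    rw [laplaceTransform, ← h1]; ring
  rw [h3, ← h2, ← integral_const_mul, laplaceTransform]
  congr 1
  ext t
  rw [← mul_assoc, ← Complex.exp_add]
  congr 2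
  push_cast
  ring

lemma laplaceTransform_deriv (hc : ContinuousOn h (Ici 0)) (hb : ∀ t, 0 ≤ t → ‖h t‖ ≤ M)
    {M' : ℝ} (kc : ContinuousOn k (Ici 0)) (kb : ∀ t, 0 ≤ t → ‖k t‖ ≤ M')
    (hk : ∀ t, 0 < t → HasDerivAt h (k t) t) (hz : 0 < z.re) :
    laplaceTransform k z = z * laplaceTransform h z - h 0 := by
  have ih := integrableOn_laplace hc hb hz
  have ik := integrableOn_laplace kc kb hz
  have hlim : Tendsto (fun t : ℝ => Complex.exp (-z * t) * h t) atTop (𝓝 0) := by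
    have h1 : Tendsto (fun t : ℝ => Real.exp (-z.re * t) * M) atTop (𝓝 0) := by
      have : Tendsto (fun t : ℝ => -z.re * t) atTop atBot :=
        tendsto_id.const_mul_atTop_of_neg (by linarith)
      simpa using (Real.tendsto_exp_atBot.comp this).mul_const M
    refine squeeze_zero_norm' ?_ h1
    filter_upwards [eventually_ge_atTop 0] with t ht using norm_laplace_integrand_le hb z ht
  have key := integral_Ioi_of_hasDerivAt_of_tendsto (a := (0 : ℝ))
    (f := fun t : ℝ => Complex.exp (-z * t) * h t)
    (f' := fun t : ℝ => Complex.exp (-z * t) * k t - z * (Complex.exp (-z * t) * h t))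
    ?_ ?_ (ik.sub (ih.const_mul z)) hlim
  · rw [integral_sub ik (ih.const_mul z), integral_const_mul] at key
    simp only [laplaceTransform]
    simp only [Complex.ofReal_zero, mul_zero, Complex.exp_zero, one_mul, zero_sub] at key
    linear_combination key
  · exact ContinuousWithinAt.mul (by fun_prop) (hc 0 self_mem_Ici)
  · intro t ht
    have h1 : HasDerivAt (fun t : ℝ => -z * (t : ℂ)) (-z * 1) t :=
      (hasDerivAt_id t).ofReal_comp.const_mul (-z)
    exact (h1.cexp.mul (hk t ht)).congr_deriv (by ring)

/-- Translation multiplies the Abel mean of a bounded function at frequency `ω` by `e^{iωs}`. -/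
lemma tendsto_abel_comp_add (hc : ContinuousOn h (Ici 0)) (hb : ∀ t, 0 ≤ t → ‖h t‖ ≤ M)
    {z c : ℂ} (hz : z.re = 0) {l : Filter ℝ} (hl : l ≤ 𝓝[>] 0)
    (hlim : Tendsto (fun a : ℝ => (a : ℂ) * laplaceTransform h (z + a)) l (𝓝 c))
    {s : ℝ} (hs : 0 ≤ s) :
    Tendsto (fun a : ℝ => (a : ℂ) * laplaceTransform (fun t => h (t + s)) (z + a)) l
      (𝓝 (Complex.exp (z * s) * c)) := by
  have hl0 : Tendsto (fun a : ℝ => (a : ℂ)) l (𝓝 0) := by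
    have : Tendsto (fun a : ℝ => (a : ℂ)) (𝓝 0) (𝓝 ((0 : ℝ) : ℂ)) :=
      Complex.continuous_ofReal.tendsto 0
    rw [Complex.ofReal_zero] at this
    exact this.mono_left (hl.trans nhdsWithin_le_nhds)
  have hpos : ∀ᶠ a in l, (0 : ℝ) < a := hl self_mem_nhdsWithin
  have h1 : Tendsto (fun a : ℝ => Complex.exp ((z + a) * s)) l (𝓝 (Complex.exp (z * s))) := by
    have h2 : Tendsto (fun a : ℝ => (z + a) * s) l (𝓝 ((z + 0) * s)) :=
      (hl0.const_add z).mul_const _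
    rw [add_zero] at h2
    exact (Complex.continuous_exp.tendsto _).comp h2
  have h3 : Tendsto
      (fun a : ℝ => (a : ℂ) * ∫ t in (0 : ℝ)..s, Complex.exp (-(z + a) * t) * h t) l (𝓝 0) := by
    have h4 : Tendsto (fun a : ℝ => ‖(a : ℂ)‖ * (M * |s - 0|)) l (𝓝 0) := by
      simpa using hl0.norm.mul_const (M * |s - 0|)
    refine squeeze_zero_norm' ?_ h4
    filter_upwards [hpos] with a ha
    rw [norm_mul]
    refine mul_le_mul_of_nonneg_left ?_ (norm_nonneg _)
    refine intervalIntegral.norm_integral_le_of_norm_le_const fun t ht => ?_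
    rw [uIoc_of_le hs] at ht
    refine (norm_laplace_integrand_le hb _ ht.1.le).trans ?_
    have hM : 0 ≤ M := (norm_nonneg _).trans (hb t ht.1.le)
    have : Real.exp (-(z + a).re * t) ≤ 1 := by
      rw [Real.exp_le_one_iff]
      simp [hz]
      nlinarith [ht.1]
    nlinarith
  have h5 := h1.mul (hlim.sub h3)
  rw [sub_zero] at h5
  refine h5.congr' ?_
  filter_upwards [hpos] with a ha
  rw [laplaceTransform_comp_add hc hb (by simpa [hz] using ha) hs]
  ring

end Laplace

/-- A holomorphic function on a disc centred on the imaginary axis which is `O(1 / |Re z|)` satisfies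
a bound that does not degenerate at the axis. -/
lemma norm_mul_le_of_norm_mul_abs_re_le {f : ℂ → ℂ} {M r : ℝ} {c w : ℂ} (hc : c.re = 0)
    (hr : 0 < r) (hf : DifferentiableOn ℂ f (Metric.closedBall c r))
    (hM : ∀ z ∈ Metric.sphere c r, z.re ≠ 0 → ‖f z‖ * |z.re| ≤ M)
    (hM0 : 0 ≤ M) (hw : w ∈ Metric.closedBall c r) :
    (r ^ 2 - ‖w - c‖ ^ 2) * ‖f w‖ ≤ 2 * r * M := by
  have hd : DifferentiableOn ℂ (fun z => ((z - c) ^ 2 + r ^ 2) * f z) (Metric.closedBall c r) :=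
    DifferentiableOn.mul (by fun_prop) hf
  have key : ‖((w - c) ^ 2 + r ^ 2) * f w‖ ≤ 2 * r * M := by
    refine Complex.norm_le_of_forall_mem_frontier_norm_le Metric.isBounded_ball
      (DifferentiableOn.diffContOnCl (f := fun z => ((z - c) ^ 2 + r ^ 2) * f z)
        (hd.mono Metric.closure_ball_subset_closedBall)) ?_
      (by rwa [closure_ball _ hr.ne'])
    intro z hz
    rw [frontier_ball _ hr.ne'] at hz
    have hzn : ‖z - c‖ = r := by simpa [dist_eq_norm] using hz
    have hre : (z - c).re = z.re := by simp [hc]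
    have hfac : (z - c) ^ 2 + (r : ℂ) ^ 2 = (z - c) * ((2 * z.re : ℝ) : ℂ) := by
      rw [← hre, ← Complex.add_conj, mul_add, Complex.mul_conj, Complex.normSq_eq_norm_sq, hzn]
      push_cast
      ring
    rw [hfac, norm_mul, norm_mul, hzn, Complex.norm_real, Real.norm_eq_abs, abs_mul,
      abs_of_pos (two_pos : (0 : ℝ) < 2)]
    by_cases h0 : z.re = 0
    · rw [h0]; simp; positivity
    · nlinarith [hM z hz h0]
  refine le_trans ?_ key
  rw [norm_mul]
  refine mul_le_mul_of_nonneg_right ?_ (norm_nonneg _)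
  have h1 : ‖(r : ℂ) ^ 2‖ - ‖-(w - c) ^ 2‖ ≤ ‖(r : ℂ) ^ 2 - -(w - c) ^ 2‖ := norm_sub_norm_le _ _
  rw [norm_neg, norm_pow, norm_pow, Complex.norm_real, Real.norm_of_nonneg hr.le] at h1
  rwa [sub_neg_eq_add, add_comm ((r : ℂ) ^ 2)] at h1

lemma exists_isolated_of_isClosed_of_countable {N : Set ℂ} (hN : IsClosed N)
    (hcount : N.Countable) (hne : N.Nonempty) : ∃ z ∈ N, ∀ᶠ w in 𝓝[≠] z, w ∉ N := by
  by_contra! hcon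
  have hperf : Perfect N := by
    refine ⟨hN, fun z hz => ?_⟩
    rw [accPt_iff_frequently_nhdsNE]
    exact fun h => hcon z hz h
  obtain ⟨f, hf, -, hinj⟩ := hperf.exists_nat_bool_injection hne
  have h1 : (range f).Countable := hcount.mono hf
  have : Countable (ℕ → Bool) := by
    rw [← Set.countable_univ_iff]
    exact Set.MapsTo.countable_of_injOn (fun x _ => mem_range_self x) hinj.injOn h1
  rw [← Cardinal.mk_le_aleph0_iff] at this
  simp only [Cardinal.mk_pi, Cardinal.mk_bool, Cardinal.prod_const, Cardinal.lift_id,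
    Cardinal.mk_nat] at this
  exact (Cardinal.cantor _).not_ge this

/-- The points near which a function defined off the imaginary axis extends holomorphically. -/
def regularSet (G : ℂ → ℂ) : Set ℂ :=
  {z | ∃ F : ℂ → ℂ, AnalyticAt ℂ F z ∧ F =ᶠ[𝓝[{w | w.re ≠ 0}] z] G}

/-- Extension by limits of a function from the complement of the imaginary axis. -/
def axisExtension (G : ℂ → ℂ) (z : ℂ) : ℂ :=
  open Classical in if z.re = 0 then limUnder (𝓝[{w | w.re ≠ 0}] z) G else G z

section Extension

variable {G : ℂ → ℂ} {z : ℂ}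

lemma isOpen_re_ne_zero : IsOpen {w : ℂ | w.re ≠ 0} :=
  isOpen_ne_fun Complex.continuous_re continuous_const

lemma nhdsWithin_re_ne_zero_neBot (hz : z.re = 0) : (𝓝[{w : ℂ | w.re ≠ 0}] z).NeBot := by
  have h1 : Tendsto (fun a : ℝ => z + a) (𝓝[>] 0) (𝓝[{w : ℂ | w.re ≠ 0}] z) := by
    refine tendsto_nhdsWithin_iff.2 ⟨?_, ?_⟩
    · have : Tendsto (fun a : ℝ => z + a) (𝓝 0) (𝓝 (z + (0 : ℝ))) :=
        (continuous_const.add Complex.continuous_ofReal).tendsto 0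
      simpa using this.mono_left nhdsWithin_le_nhds
    · filter_upwards [self_mem_nhdsWithin] with a ha
      simpa [hz] using (ne_of_gt ha)
  exact h1.neBot

lemma axisExtension_of_re_ne_zero (hz : z.re ≠ 0) : axisExtension G z = G z := by
  simp [axisExtension, hz]

lemma axisExtension_eventuallyEq {F : ℂ → ℂ} (hF : AnalyticAt ℂ F z)
    (hFG : F =ᶠ[𝓝[{w | w.re ≠ 0}] z] G) : axisExtension G =ᶠ[𝓝 z] F := by
  have h1 : ∀ᶠ w in 𝓝 z, w.re ≠ 0 → F w = G w := eventually_nhdsWithin_iff.1 hFG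
  filter_upwards [h1.eventually_nhds, hF.eventually_analyticAt] with w hw hFw
  by_cases h0 : w.re = 0
  · have := nhdsWithin_re_ne_zero_neBot h0
    have h2 : Tendsto G (𝓝[{w | w.re ≠ 0}] w) (𝓝 (F w)) :=
      (hFw.continuousAt.tendsto.mono_left nhdsWithin_le_nhds).congr'
        (eventually_nhdsWithin_iff.2 hw)
    simp [axisExtension, h0, h2.limUnder_eq]
  · rw [axisExtension_of_re_ne_zero h0, hw.self_of_nhds h0]

lemma analyticAt_axisExtension (hz : z ∈ regularSet G) : AnalyticAt ℂ (axisExtension G) z := by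
  obtain ⟨F, hF, hFG⟩ := hz
  exact hF.congr (axisExtension_eventuallyEq hF hFG).symm

lemma isOpen_regularSet (G : ℂ → ℂ) : IsOpen (regularSet G) := by
  rw [isOpen_iff_eventually]
  rintro z ⟨F, hF, hFG⟩
  have h1 : ∀ᶠ w in 𝓝 z, w.re ≠ 0 → F w = G w := eventually_nhdsWithin_iff.1 hFG
  filter_upwards [h1.eventually_nhds, hF.eventually_analyticAt] with w hw hFw
  exact ⟨F, hFw, eventually_nhdsWithin_iff.2 hw⟩

lemma mem_regularSet_of_re_ne_zero (hG : DifferentiableOn ℂ G {w | w.re ≠ 0}) (hz : z.re ≠ 0) :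
    z ∈ regularSet G :=
  ⟨G, hG.analyticAt (isOpen_re_ne_zero.mem_nhds hz), EventuallyEq.rfl⟩

/-- An isolated singularity on the axis of a function that is `O(1 / |Re z|)` is removable as soon
as the radial limit defining its residue can only be zero. -/
lemma mem_regularSet_of_isolated {M : ℝ} (hM0 : 0 ≤ M)
    (hM : ∀ z : ℂ, z.re ≠ 0 → ‖G z‖ * |z.re| ≤ M) (hz : z.re = 0)
    (hiso : ∀ᶠ w in 𝓝[≠] z, w ∈ regularSet G)
    (hres : ∀ c : ℂ, Tendsto (fun a : ℝ => (a : ℂ) * G (z + a)) (𝓝[>] 0) (𝓝 c) → c = 0) :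
    z ∈ regularSet G := by
  set H := axisExtension G with hH
  obtain ⟨r, hr, hball⟩ := Metric.mem_nhdsWithin_iff.1 hiso
  have hHd : ∀ w ∈ Metric.ball z r, w ≠ z → DifferentiableAt ℂ H w := fun w hw hwz =>
    (analyticAt_axisExtension (hball ⟨hw, hwz⟩)).differentiableAt
  have hHM : ∀ w : ℂ, w.re ≠ 0 → ‖H w‖ * |w.re| ≤ M := fun w hw => by
    rw [hH, axisExtension_of_re_ne_zero hw]; exact hM w hw
  have hbound : ∀ w ∈ Metric.ball z (r / 2), w ≠ z → ‖(w - z) * H w‖ ≤ 16 * M := by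
    intro w hw hwz
    have hwr : ‖w - z‖ < r / 2 := by simpa [dist_eq_norm] using hw
    have hre : |w.re| = |(w - z).re| := by simp [hz]
    have hle : ‖w - z‖ ≤ |(w - z).re| + |(w - z).im| := Complex.norm_le_abs_re_add_abs_im _
    have hpos : 0 < ‖w - z‖ := norm_pos_iff.2 (sub_ne_zero.2 hwz)
    set x := |(w - z).re|
    set y := |(w - z).im|
    rw [norm_mul]
    have hx0 : 0 ≤ x := abs_nonneg _
    by_cases hxy : y ≤ 2 * x
    · have h1 := hHM w (by
        intro h0
        rw [h0, abs_zero] at hre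
        linarith)
      rw [hre] at h1
      nlinarith [norm_nonneg (H w)]
    · have hxy' : 2 * x < y := not_le.1 hxy
      have hx0' : x < y := by linarith
      have hy0 : 0 < y := by linarith
      have hyr : y < r / 2 := (Complex.abs_im_le_norm _).trans_lt hwr
      set c : ℂ := z + ((w - z).im : ℂ) * Complex.I with hc
      have hcz : ‖c - z‖ = y := by
        rw [hc, add_sub_cancel_left, norm_mul, Complex.norm_I, mul_one, Complex.norm_real,
          Real.norm_eq_abs]
      have hwc : ‖w - c‖ = x := by
        have : w - c = ((w - z).re : ℂ) := by
          rw [hc, ← sub_sub, sub_eq_iff_eq_add]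
          exact (Complex.re_add_im (w - z)).symm
        rw [this, Complex.norm_real, Real.norm_eq_abs]
      have hsub : ∀ v ∈ Metric.closedBall c (3 / 4 * y), v ∈ Metric.ball z r ∧ v ≠ z := by
        intro v hv
        have hv' : ‖v - c‖ ≤ 3 / 4 * y := by simpa [dist_eq_norm] using hv
        refine ⟨?_, ?_⟩
        · rw [Metric.mem_ball, dist_eq_norm, ← sub_add_sub_cancel v c z]
          refine (norm_add_le _ _).trans_lt ?_
          linarith
        · rintro rfl
          rw [norm_sub_rev, hcz] at hv'
          linarith
      have h1 := norm_mul_le_of_norm_mul_abs_re_le (f := H) (M := M) (r := 3 / 4 * y) (c := c)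
        (w := w) (by simp [hc, hz]) (by linarith)
        (fun v hv => (hHd v (hsub v hv).1 (hsub v hv).2).differentiableWithinAt)
        (fun v _ hv => hHM v hv) hM0
        (by rw [Metric.mem_closedBall, dist_eq_norm, hwc]; linarith)
      rw [hwc] at h1
      have h2 : (5 / 16 * y ^ 2) * ‖H w‖ ≤ 2 * (3 / 4 * y) * M := by
        refine le_trans (mul_le_mul_of_nonneg_right ?_ (norm_nonneg _)) h1
        nlinarith
      have h3 : y * ‖H w‖ ≤ 24 / 5 * M := by
        refine le_of_mul_le_mul_left ?_ hy0
        linarith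
      have h4 : ‖w - z‖ ≤ 3 / 2 * y := by linarith
      have h5 := mul_le_mul_of_nonneg_right h4 (norm_nonneg (H w))
      linarith
  have hHd' : ∀ᶠ w in 𝓝[≠] z, DifferentiableAt ℂ H w := by
    filter_upwards [hiso] with w hw using (analyticAt_axisExtension hw).differentiableAt
  have hlim := Complex.tendsto_limUnder_of_differentiable_on_punctured_nhds_of_bounded_under
    (f := fun w => (w - z) * H w) (c := z)
    (by filter_upwards [hHd'] with w hw using by fun_prop)
    (by
      refine isBoundedUnder_of_eventually_le (a := 16 * M) ?_
      filter_upwards [mem_nhdsWithin_of_mem_nhds (Metric.ball_mem_nhds z (half_pos hr)),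
        self_mem_nhdsWithin] with w hw hwz
      simpa using hbound w hw hwz)
  set c := limUnder (𝓝[≠] z) fun w => (w - z) * H w
  have hc0 : c = 0 := by
    refine hres c ?_
    have h1 : Tendsto (fun a : ℝ => z + a) (𝓝[>] 0) (𝓝[≠] z) := by
      refine tendsto_nhdsWithin_iff.2 ⟨?_, ?_⟩
      · have : Tendsto (fun a : ℝ => z + a) (𝓝 0) (𝓝 (z + (0 : ℝ))) :=
          (continuous_const.add Complex.continuous_ofReal).tendsto 0
        simpa using this.mono_left nhdsWithin_le_nhds
      · filter_upwards [self_mem_nhdsWithin] with a ha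
        simpa using (ne_of_gt ha)
    refine (hlim.comp h1).congr' ?_
    filter_upwards [self_mem_nhdsWithin] with a ha
    have : (z + a).re ≠ 0 := by simpa [hz] using (ne_of_gt ha)
    simp [hH, axisExtension_of_re_ne_zero this]
  rw [hc0] at hlim
  have hlo : (fun w => H w - H z) =o[𝓝[≠] z] fun w => (w - z)⁻¹ := by
    rw [Asymptotics.isLittleO_iff_tendsto']
    · have h1 : Tendsto (fun w => (w - z) * H z) (𝓝[≠] z) (𝓝 0) := by
        have : Tendsto (fun w => (w - z) * H z) (𝓝 z) (𝓝 ((z - z) * H z)) :=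
          Continuous.tendsto (by fun_prop) z
        simpa using this.mono_left nhdsWithin_le_nhds
      have h2 := hlim.sub h1
      rw [sub_zero] at h2
      refine h2.congr fun w => ?_
      rw [div_inv_eq_mul]
      ring
    · filter_upwards [self_mem_nhdsWithin] with w hw h0
      exact absurd h0 (inv_ne_zero (sub_ne_zero.2 hw))
  have hupd := Complex.differentiableOn_update_limUnder_of_isLittleO (Metric.ball_mem_nhds z hr)
    (fun w hw => (hHd w hw.1 hw.2).differentiableWithinAt) hlo
  refine ⟨_, hupd.analyticAt (Metric.ball_mem_nhds z hr), ?_⟩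
  filter_upwards [self_mem_nhdsWithin] with w hw
  have hw' : w.re ≠ 0 := hw
  rw [Function.update_of_ne (by rintro rfl; exact hw' hz), hH, axisExtension_of_re_ne_zero hw']

/-- A holomorphic function off the imaginary axis that is `O(1 / |Re z|)`, extends across all but
countably many points of the axis and has no nonzero radial residue on the axis, vanishes. -/
theorem eq_zero_of_countable_compl_regularSet {M : ℝ} (hM0 : 0 ≤ M)
    (hG : DifferentiableOn ℂ G {w | w.re ≠ 0})
    (hM : ∀ z : ℂ, z.re ≠ 0 → ‖G z‖ * |z.re| ≤ M)
    (hcount : (regularSet G)ᶜ.Countable)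
    (hres : ∀ z : ℂ, z.re = 0 → ∀ c : ℂ,
      Tendsto (fun a : ℝ => (a : ℂ) * G (z + a)) (𝓝[>] 0) (𝓝 c) → c = 0)
    (hz : z.re ≠ 0) : G z = 0 := by
  have hall : ∀ w, w ∈ regularSet G := by
    by_contra! hne
    obtain ⟨w, hw, hiso⟩ := exists_isolated_of_isClosed_of_countable
      (isOpen_regularSet G).isClosed_compl hcount hne
    have hw0 : w.re = 0 := by
      by_contra h0
      exact hw (mem_regularSet_of_re_ne_zero hG h0)
    exact hw (mem_regularSet_of_isolated hM0 hM hw0 (by simpa using hiso) (hres w hw0))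
  have hlarge : ∀ᶠ r : ℝ in atTop, ‖G z‖ ≤ 2 * r * M / (r ^ 2 - ‖z‖ ^ 2) := by
    filter_upwards [eventually_gt_atTop ‖z‖] with r hr
    have hr0 : 0 < r := (norm_nonneg z).trans_lt hr
    have h1 := norm_mul_le_of_norm_mul_abs_re_le (f := axisExtension G) (M := M) (r := r) (c := 0)
      (w := z) rfl hr0
      (fun v _ => (analyticAt_axisExtension (hall v)).differentiableAt.differentiableWithinAt)
      (fun v _ hv => by rw [axisExtension_of_re_ne_zero hv]; exact hM v hv) hM0
      (by simpa using hr.le)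
    rw [sub_zero, axisExtension_of_re_ne_zero hz] at h1
    rw [le_div_iff₀ (by nlinarith [norm_nonneg z]), mul_comm]
    exact h1
  have hlim : Tendsto (fun r : ℝ => 2 * r * M / (r ^ 2 - ‖z‖ ^ 2)) atTop (𝓝 0) := by
    have h1 : Tendsto (fun r : ℝ => 2 * M / (r - ‖z‖ ^ 2 * r⁻¹)) atTop (𝓝 0) := by
      refine Tendsto.const_div_atTop ?_ _
      have h2 : Tendsto (fun r : ℝ => -(‖z‖ ^ 2 * r⁻¹)) atTop (𝓝 (-(‖z‖ ^ 2 * 0))) :=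
        (tendsto_inv_atTop_zero.const_mul _).neg
      simpa [sub_eq_add_neg] using tendsto_id.atTop_add h2
    refine h1.congr' ?_
    filter_upwards [eventually_gt_atTop 0] with r hr
    have : r ^ 2 - ‖z‖ ^ 2 = (r - ‖z‖ ^ 2 * r⁻¹) * r := by field_simp
    rw [this, ← mul_div_mul_right (2 * M) _ hr.ne']
    ring
  exact norm_le_zero_iff.1 (ge_of_tendsto hlim hlarge)

end Extension

lemma laplaceTransform_congr {h k : ℝ → ℂ} (hhk : ∀ t, 0 < t → h t = k t) (z : ℂ) :
    laplaceTransform h z = laplaceTransform k z :=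
  setIntegral_congr_fun measurableSet_Ioi fun t ht => by simp only [hhk t ht]

/-- Banach–Alaoglu along an ultrafilter. -/
lemma exists_tendsto_apply_of_norm_le {E ι : Type*} [NormedAddCommGroup E] [NormedSpace ℂ E]
    (U : Ultrafilter ι) (g : ι → E →L[ℂ] ℂ) {M : ℝ} (hg : ∀ᶠ i in (U : Filter ι), ‖g i‖ ≤ M) :
    ∃ φ : E →L[ℂ] ℂ, ‖φ‖ ≤ M ∧ ∀ y, Tendsto (fun i => g i y) U (𝓝 (φ y)) := by
  obtain ⟨φ, hφ, hlim⟩ := (WeakDual.isCompact_closedBall (0 : StrongDual ℂ E) M).ultrafilter_le_nhds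
    (U.map fun i => StrongDual.toWeakDual (g i)) (by
      rw [le_principal_iff]
      exact hg.mono fun i hi => by simpa using hi)
  refine ⟨WeakDual.toStrongDual φ, by simpa using hφ, fun y => ?_⟩
  exact ((WeakDual.eval_continuous y).tendsto φ).comp hlim

section Semigroup

variable {X : Type*} [NormedAddCommGroup X] [NormedSpace ℂ X] {T : ℝ → X →L[ℂ] X} {M : ℝ}

/-- If some orbit of a bounded semigroup does not tend to zero, then the adjoint semigroup has a
nonzero bounded trajectory defined on the whole real line. -/
lemma exists_complete_trajectory
    (hTsemi : ∀ s t : ℝ, 0 ≤ s → 0 ≤ t → T (s + t) = T s ∘L T t)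
    (hM : ∀ t : ℝ, 0 ≤ t → ‖T t‖ ≤ M) {x : X} (hx : ¬ Tendsto (fun t => T t x) atTop (𝓝 0)) :
    ∃ ψ : ℝ → X →L[ℂ] ℂ, (∀ s, ‖ψ s‖ ≤ M) ∧ (∀ s r, 0 ≤ r → ψ (s + r) = ψ s ∘L T r) ∧
      ψ 0 ≠ 0 := by
  obtain ⟨ε, hε, hfreq⟩ : ∃ ε > 0, ∃ᶠ t in atTop, ε ≤ ‖T t x‖ := by
    rw [Metric.tendsto_nhds] at hx
    push Not at hx
    obtain ⟨ε, hε, h⟩ := hx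
    exact ⟨ε, hε, h.mono fun t ht => by simpa using ht⟩
  have hne : (atTop ⊓ 𝓟 {t : ℝ | ε ≤ ‖T t x‖}).NeBot := frequently_iff_neBot.1 hfreq
  set U := Ultrafilter.of (atTop ⊓ 𝓟 {t : ℝ | ε ≤ ‖T t x‖})
  have hUle : (U : Filter ℝ) ≤ atTop ⊓ 𝓟 {t : ℝ | ε ≤ ‖T t x‖} := Ultrafilter.of_le _
  have hUtop : (U : Filter ℝ) ≤ atTop := hUle.trans inf_le_left
  have hUε : ∀ᶠ t in (U : Filter ℝ), ε ≤ ‖T t x‖ :=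
    (hUle.trans inf_le_right) (mem_principal_self _)
  choose φ hφ1 hφ2 using fun t : ℝ => exists_dual_vector'' ℂ (T t x)
  have hlarge : ∀ s : ℝ, ∀ᶠ t in (U : Filter ℝ), 0 ≤ t + s := fun s =>
    hUtop ((eventually_ge_atTop (-s)).mono fun t ht => by linarith)
  have hbd : ∀ s : ℝ, ∀ᶠ t in (U : Filter ℝ), ‖φ t ∘L T (t + s)‖ ≤ M := fun s =>
    (hlarge s).mono fun t ht => (ContinuousLinearMap.opNorm_comp_le _ _).trans <|
      (mul_le_of_le_one_left (norm_nonneg _) (hφ1 t)).trans (hM _ ht)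
  choose ψ hψM hψlim using fun s : ℝ => exists_tendsto_apply_of_norm_le U _ (hbd s)
  refine ⟨ψ, hψM, fun s r hr => ?_, fun h0 => ?_⟩
  · ext y
    refine tendsto_nhds_unique (hψlim (s + r) y) ((hψlim s (T r y)).congr' ?_)
    filter_upwards [hlarge s] with t ht
    rw [← add_assoc, hTsemi (t + s) r ht hr]
    rfl
  · have h1 := (hψlim 0 x).norm
    rw [h0] at h1
    have h2 : ε ≤ ‖(0 : X →L[ℂ] ℂ) x‖ := by
      refine ge_of_tendsto h1 (hUε.mono fun t ht => ?_)
      simpa [hφ2] using ht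
    simp at h2
    linarith

/-- On a reflexive space, a nonzero Abel mean at a purely imaginary frequency `z` of a scalar orbit
of a bounded semigroup produces an eigenvector of the generator. -/
lemma abel_mean_eq_zero
    (hrefl : Function.Surjective (NormedSpace.inclusionInDoubleDual ℂ X))
    (hTsemi : ∀ s t : ℝ, 0 ≤ s → 0 ≤ t → T (s + t) = T s ∘L T t)
    (hTcont : ∀ x : X, ContinuousOn (fun t => T t x) (Ici 0))
    (hM : ∀ t : ℝ, 0 ≤ t → ‖T t‖ ≤ M)
    {z : ℂ} (hz : z.re = 0)
    (heig : ∀ x : X, (∀ s : ℝ, 0 ≤ s → T s x = Complex.exp (z * s) • x) → x = 0)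
    (ψ : X →L[ℂ] ℂ) (y : X) {c : ℂ}
    (hlim : Tendsto (fun a : ℝ => (a : ℂ) * laplaceTransform (fun t => ψ (T t y)) (z + a))
      (𝓝[>] 0) (𝓝 c)) : c = 0 := by
  have hc : ∀ f : X →L[ℂ] ℂ, ContinuousOn (fun t => f (T t y)) (Ici 0) := fun f =>
    f.continuous.comp_continuousOn (hTcont y)
  have hb : ∀ f : X →L[ℂ] ℂ, ∀ t, 0 ≤ t → ‖f (T t y)‖ ≤ ‖f‖ * (M * ‖y‖) := fun f t ht =>
    (f.le_opNorm _).trans (mul_le_mul_of_nonneg_left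
      (((T t).le_opNorm y).trans (mul_le_mul_of_nonneg_right (hM t ht) (norm_nonneg _)))
      (norm_nonneg _))
  have hM0 : 0 ≤ M := (norm_nonneg _).trans (hM 0 le_rfl)
  have hex : ∀ a : ℝ, ∃ g : (X →L[ℂ] ℂ) →L[ℂ] ℂ, 0 < a →
      ‖g‖ ≤ M * ‖y‖ ∧ ∀ f, g f = a * laplaceTransform (fun t => f (T t y)) (z + a) := by
    intro a
    by_cases ha : 0 < a
    swap
    · exact ⟨0, fun h => absurd h ha⟩
    have hre : (z + a).re = a := by simp [hz]
    have hza : 0 < (z + a).re := by rwa [hre]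
    refine ⟨LinearMap.mkContinuous
      { toFun := fun f => a * laplaceTransform (fun t => f (T t y)) (z + a)
        map_add' := fun f g => ?_
        map_smul' := fun k f => ?_ } (M * ‖y‖) fun f => ?_, fun _ =>
      ⟨LinearMap.mkContinuous_norm_le _ (by positivity) _, fun f => rfl⟩⟩
    · simp only [add_apply]
      rw [laplaceTransform_add (hc f) (hb f) (hc g) (hb g) hza, mul_add]
    · simp only [smul_apply, smul_eq_mul, RingHom.id_apply]
      rw [laplaceTransform_const_mul]
      ring
    · have h1 := norm_laplaceTransform_le (hb f) hza
      rw [hre, le_div_iff₀ ha] at h1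
      simp only [LinearMap.coe_mk, AddHom.coe_mk, norm_mul, Complex.norm_real,
        Real.norm_of_nonneg ha.le]
      linarith
  choose g hg using hex
  set U := Ultrafilter.of (𝓝[>] (0 : ℝ))
  have hU : (U : Filter ℝ) ≤ 𝓝[>] 0 := Ultrafilter.of_le _
  have hpos : ∀ᶠ a in (U : Filter ℝ), (0 : ℝ) < a := hU self_mem_nhdsWithin
  obtain ⟨Λ, -, hΛ⟩ := exists_tendsto_apply_of_norm_le U g (hpos.mono fun a ha => (hg a ha).1)
  have hΛ' : ∀ f : X →L[ℂ] ℂ, Tendsto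
      (fun a : ℝ => (a : ℂ) * laplaceTransform (fun t => f (T t y)) (z + a)) U (𝓝 (Λ f)) :=
    fun f => (hΛ f).congr' (hpos.mono fun a ha => (hg a ha).2 f)
  obtain ⟨w, hw⟩ := hrefl Λ
  have hwf : ∀ f : X →L[ℂ] ℂ, f w = Λ f := fun f => by rw [← hw]; rfl
  have hw0 : w = 0 := by
    refine heig w fun s hs => ?_
    refine (SeparatingDual.eq_iff_forall_dual_eq (R := ℂ)).2 fun f => ?_
    have h1 := tendsto_abel_comp_add (hc f) (hb f) hz hU (hΛ' f) hs
    have h2 := hΛ' (f ∘L T s)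
    rw [map_smul, smul_eq_mul, hwf f]
    have h3 : f (T s w) = Λ (f ∘L T s) := hwf (f ∘L T s)
    rw [h3]
    refine tendsto_nhds_unique h2 (h1.congr fun a => ?_)
    congr 1
    refine laplaceTransform_congr (fun t ht => ?_) _
    rw [add_comm t s, hTsemi s t hs ht.le]
    rfl
  have h1 := hwf ψ
  rw [hw0, map_zero] at h1
  rw [tendsto_nhds_unique (hlim.mono_left hU) (hΛ' ψ), ← h1]

/-- The Carleman transform of `h : ℝ → ℂ`. -/
def carlemanTransform (h : ℝ → ℂ) (z : ℂ) : ℂ :=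
  open Classical in
  if 0 < z.re then laplaceTransform h z else -laplaceTransform (fun t => h (-t)) (-z)

lemma differentiableOn_carlemanTransform {h : ℝ → ℂ} {M : ℝ} (hc : Continuous h)
    (hb : ∀ t, ‖h t‖ ≤ M) : DifferentiableOn ℂ (carlemanTransform h) {z | z.re ≠ 0} := by
  intro z hz
  refine DifferentiableAt.differentiableWithinAt ?_
  rcases lt_or_gt_of_ne hz with h0 | h0
  · have h1 : DifferentiableAt ℂ (laplaceTransform fun t => h (-t)) (-z) :=
      differentiableAt_laplaceTransform (hc.comp continuous_neg).continuousOn (fun t _ => hb (-t))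
        (by simpa using h0)
    have h2 : DifferentiableAt ℂ (fun z => -laplaceTransform (fun t => h (-t)) (-z)) z :=
      (DifferentiableAt.comp z h1 differentiableAt_id.neg).neg
    refine h2.congr_of_eventuallyEq ?_
    filter_upwards [(isOpen_lt Complex.continuous_re continuous_const).mem_nhds h0] with w hw
    have hw' : w.re < 0 := hw
    simp [carlemanTransform, hw'.not_gt]
  · refine (differentiableAt_laplaceTransform hc.continuousOn (fun t _ => hb t)
      h0).congr_of_eventuallyEq ?_
    filter_upwards [(isOpen_lt continuous_const Complex.continuous_re).mem_nhds h0] with w hw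
    have hw' : 0 < w.re := hw
    simp [carlemanTransform, hw']

lemma norm_carlemanTransform_mul_le {h : ℝ → ℂ} {M : ℝ} (hb : ∀ t, ‖h t‖ ≤ M) {z : ℂ}
    (hz : z.re ≠ 0) : ‖carlemanTransform h z‖ * |z.re| ≤ M := by
  rcases lt_or_gt_of_ne hz with h0 | h0
  · have h0' : 0 < (-z).re := by simpa using h0
    have h1 := norm_laplaceTransform_le (h := fun t => h (-t)) (fun t _ => hb (-t)) h0'
    rw [le_div_iff₀ h0'] at h1
    simpa [carlemanTransform, h0.not_gt, abs_of_neg h0] using h1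
  · have h1 := norm_laplaceTransform_le (fun t _ => hb t) h0
    rw [le_div_iff₀ h0] at h1
    simpa [carlemanTransform, h0, abs_of_pos h0] using h1

/-- The Carleman transform of `z h - h'` at `z` is `h 0`. -/
lemma carlemanTransform_mul_sub_deriv {h k : ℝ → ℂ} {M M' : ℝ} (hc : Continuous h)
    (hb : ∀ t, ‖h t‖ ≤ M) (kc : Continuous k) (kb : ∀ t, ‖k t‖ ≤ M')
    (hk : ∀ t, HasDerivAt h (k t) t) {z : ℂ} (hz : z.re ≠ 0) :
    carlemanTransform (fun t => z * h t + (-1) * k t) z = h 0 := by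
  have hzb : ∀ t, ‖z * h t‖ ≤ ‖z‖ * M := fun t => by
    rw [norm_mul]; exact mul_le_mul_of_nonneg_left (hb t) (norm_nonneg _)
  have hkb : ∀ t, ‖(-1) * k t‖ ≤ M' := fun t => by simpa using kb t
  rcases lt_or_gt_of_ne hz with h0 | h0
  · have h0' : 0 < (-z).re := by simpa using h0
    have hc' : Continuous fun t => h (-t) := hc.comp continuous_neg
    have kc' : Continuous fun t => (-1) * k (-t) := (kc.comp continuous_neg).const_mul _
    rw [carlemanTransform, if_neg h0.not_gt,
      laplaceTransform_add (hc'.const_mul z).continuousOn (fun t _ => hzb (-t))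
        kc'.continuousOn (fun t _ => hkb (-t)) h0',
      laplaceTransform_const_mul z,
      laplaceTransform_deriv (h := fun t => h (-t)) hc'.continuousOn (fun t _ => hb (-t))
        kc'.continuousOn (fun t _ => hkb (-t))
        (fun t _ => ((hk (-t)).scomp t (hasDerivAt_neg t)).congr_deriv (by simp)) h0']
    simp
  · have kc' : Continuous fun t => (-1) * k t := kc.const_mul _
    rw [carlemanTransform, if_pos h0,
      laplaceTransform_add (hc.const_mul z).continuousOn (fun t _ => hzb t)
        kc'.continuousOn (fun t _ => hkb t) h0,
      laplaceTransform_const_mul z, laplaceTransform_const_mul (-1),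
      laplaceTransform_deriv hc.continuousOn (fun t _ => hb t)
        kc.continuousOn (fun t _ => kb t) (fun t _ => hk t) h0]
    ring

section Trajectory

variable {ψ : ℝ → X →L[ℂ] ℂ}

lemma continuous_trajectory (hTcont : ∀ x : X, ContinuousOn (fun t => T t x) (Ici 0))
    (hψ : ∀ s r, 0 ≤ r → ψ (s + r) = ψ s ∘L T r) (y : X) : Continuous fun s => ψ s y := by
  refine continuous_iff_continuousAt.2 fun s => ?_
  have h1 : ContinuousOn (fun t => ψ (s - 1) (T (t - (s - 1)) y)) (Ici (s - 1)) :=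
    (ψ (s - 1)).continuous.comp_continuousOn
      ((hTcont y).comp (by fun_prop) fun t ht => by simpa using ht)
  have h2 : ContinuousOn (fun t => ψ t y) (Ici (s - 1)) := by
    refine h1.congr fun t ht => ?_
    have ht' : s - 1 ≤ t := ht
    have := hψ (s - 1) (t - (s - 1)) (by linarith)
    rw [add_sub_cancel] at this
    simp only [this]
    rfl
  exact h2.continuousAt (Ici_mem_nhds (by linarith))

lemma hasDerivAt_trajectory (hT0 : T 0 = 1)
    (hTcont : ∀ x : X, ContinuousOn (fun t => T t x) (Ici 0))
    (hψ : ∀ s r, 0 ≤ r → ψ (s + r) = ψ s ∘L T r) {x x' : X}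
    (hx : HasDerivWithinAt (fun t => T t x) x' (Ici 0) 0) (s : ℝ) :
    HasDerivAt (fun t => ψ t x) (ψ s x') s := by
  have hcx := continuous_trajectory hTcont hψ x
  have hcx' := continuous_trajectory hTcont hψ x'
  have hright : ∀ t, HasDerivWithinAt (fun t => ψ t x) (ψ t x') (Ioi t) t := by
    intro t
    have h1 : HasDerivWithinAt (fun r => ψ t (T r x)) (ψ t x') (Ici 0) (t - t) := by
      rw [sub_self]
      exact ((ψ t).restrictScalars ℝ).hasFDerivAt.comp_hasDerivWithinAt 0 hx
    have h2 : HasDerivWithinAt (fun r => ψ t (T (r - t) x)) (ψ t x') (Ici t) t := by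
      have hmaps : MapsTo (fun r => r - t) (Ici t) (Ici 0) :=
        fun r hr => mem_Ici.2 (sub_nonneg.2 (mem_Ici.1 hr))
      have := h1.scomp (h := fun r => r - t) t ((hasDerivWithinAt_id t (Ici t)).sub_const t) hmaps
      simpa [Function.comp_def] using this
    have h3 : HasDerivWithinAt (fun r => ψ r x) (ψ t x') (Ici t) t := by
      refine h2.congr (fun r hr => ?_) (by simp [hT0])
      have hr' : t ≤ r := hr
      have := hψ t (r - t) (by linarith)
      rw [add_sub_cancel] at this
      rw [this]
      rfl
    exact h3.mono Ioi_subset_Ici_self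
  have hint : ∀ u, ψ u x = ψ 0 x + ∫ t in (0 : ℝ)..u, ψ t x' := fun u => by
    rw [intervalIntegral.integral_eq_sub_of_hasDeriv_right hcx.continuousOn
      (fun t _ => hright t) (hcx'.intervalIntegrable _ _)]
    ring
  rw [funext hint]
  exact (hcx'.integral_hasStrictDerivAt 0 s).hasDerivAt.const_add _

lemma mem_regularSet_carlemanTransform {D : Submodule ℂ X} {A : X →ₗ[ℂ] X} [CompleteSpace X]
    (hT0 : T 0 = 1)
    (hTcont : ∀ x : X, ContinuousOn (fun t => T t x) (Ici 0))
    (hgen : ∀ x ∈ D, HasDerivWithinAt (fun t => T t x) (A x) (Ici 0) 0)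
    (hψM : ∀ s, ‖ψ s‖ ≤ M) (hψ : ∀ s r, 0 ≤ r → ψ (s + r) = ψ s ∘L T r)
    {z : ℂ} {R : X →L[ℂ] X} (hRD : ∀ y, R y ∈ D) (hR : ∀ y, z • R y - A (R y) = y) (y : X) :
    z ∈ regularSet (carlemanTransform fun s => ψ s y) := by
  have hb : ∀ (y : X) (s : ℝ), ‖ψ s y‖ ≤ M * ‖y‖ := fun y s =>
    ((ψ s).le_opNorm y).trans (mul_le_mul_of_nonneg_right (hψM s) (norm_nonneg _))
  set Q : ℂ → X →L[ℂ] X := fun w => 1 + (w - z) • R with hQ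
  have hQc : Continuous Q := by fun_prop
  have hQd : Differentiable ℂ Q := by fun_prop
  have hopen : IsOpen {w | IsUnit (Q w)} := Units.isOpen.preimage hQc
  have hmem : {w | IsUnit (Q w)} ∈ 𝓝 z := hopen.mem_nhds (by simp [hQ])
  have hF : DifferentiableOn ℂ (fun w => ψ 0 (R (Ring.inverse (Q w) y))) {w | IsUnit (Q w)} := by
    intro w hw
    have h1 : DifferentiableAt ℂ (fun w => Ring.inverse (Q w)) w :=
      DifferentiableAt.comp w (differentiableAt_inverse hw) (hQd w)
    have h2 : DifferentiableAt ℂ (fun w => Ring.inverse (Q w) y) w :=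
      h1.clm_apply (differentiableAt_const y)
    exact (((ψ 0) ∘L R).differentiableAt.comp w h2).differentiableWithinAt
  refine ⟨_, hF.analyticAt hmem, ?_⟩
  filter_upwards [mem_nhdsWithin_of_mem_nhds hmem, self_mem_nhdsWithin] with w hw hre
  set v := Ring.inverse (Q w) y
  have hQv : Q w v = y := by
    have := congrArg (fun S : X →L[ℂ] X => S y) (Ring.mul_inverse_cancel _ hw)
    exact this
  have hwv : y = w • R v - A (R v) := by
    rw [← hQv]
    have : Q w v = v + (w - z) • R v := rfl
    rw [this]
    nth_rewrite 1 [← hR v]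
    module
  have h1 := carlemanTransform_mul_sub_deriv (continuous_trajectory hTcont hψ (R v)) (hb (R v))
    (continuous_trajectory hTcont hψ (A (R v))) (hb (A (R v)))
    (hasDerivAt_trajectory hT0 hTcont hψ (hgen _ (hRD v))) hre
  rw [← h1]
  congr 1
  ext s
  rw [hwv]
  simp [sub_eq_add_neg]

lemma apply_eq_zero_of_laplaceTransform_eq_zero
    (hTcont : ∀ x : X, ContinuousOn (fun t => T t x) (Ici 0))
    (hψM : ∀ s, ‖ψ s‖ ≤ M) (hψ : ∀ s r, 0 ≤ r → ψ (s + r) = ψ s ∘L T r)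
    (h0 : ∀ y, laplaceTransform (fun s => ψ s y) 1 = 0) (y : X) : ψ 0 y = 0 := by
  have hc := continuous_trajectory hTcont hψ y
  have hint : ∀ s : ℝ, 0 ≤ s → ∫ t in (0 : ℝ)..s, Complex.exp (-1 * t) * ψ t y = 0 := by
    intro s hs
    have h1 := laplaceTransform_comp_add (z := 1) hc.continuousOn (fun t _ =>
      ((ψ t).le_opNorm y).trans (mul_le_mul_of_nonneg_right (hψM t) (norm_nonneg _)))
      (by simp) hs
    have h2 : (fun t => ψ (t + s) y) = fun t => ψ t (T s y) := by
      ext t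
      rw [hψ t s hs]
      rfl
    rw [h2, h0, h0] at h1
    simpa [Complex.exp_ne_zero] using h1.symm
  have hd : HasDerivAt (fun s => ∫ t in (0 : ℝ)..s, Complex.exp (-1 * t) * ψ t y)
      (Complex.exp (-1 * (0 : ℝ)) * ψ 0 y) 0 :=
    (Continuous.integral_hasStrictDerivAt (by fun_prop) 0 0).hasDerivAt
  have hd' : HasDerivWithinAt (fun s => ∫ t in (0 : ℝ)..s, Complex.exp (-1 * t) * ψ t y)
      0 (Ici 0) 0 :=
    (hasDerivWithinAt_const (0 : ℝ) (Ici 0) (0 : ℂ)).congr hint (hint 0 le_rfl)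
  have := (uniqueDiffOn_Ici (0 : ℝ) 0 self_mem_Ici).eq_deriv _ hd.hasDerivWithinAt hd'
  simpa using this

end Trajectory

end Semigroup

/-- **Arendt–Batty.** Let `(T(t))_{t≥0}` be a bounded `C₀`-semigroup on a
reflexive Banach space `X` with generator `A` (with domain `D`). If the part of the
spectrum of `A` on the imaginary axis is countable and no eigenvalue of `A` lies on
the imaginary axis, then `T(t)x → 0` as `t → ∞` for every `x ∈ X`. -/
theorem arendt_batty
    (X : Type*) [NormedAddCommGroup X] [NormedSpace ℂ X] [CompleteSpace X]
    -- `X` is reflexive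
    (hrefl : Function.Surjective (NormedSpace.inclusionInDoubleDual ℂ X))
    -- bounded `C₀`-semigroup
    (T : ℝ → X →L[ℂ] X)
    (hT0 : T 0 = 1)
    (hTsemi : ∀ s t : ℝ, 0 ≤ s → 0 ≤ t → T (s + t) = T s ∘L T t)
    (hTcont : ∀ x : X, ContinuousOn (fun t => T t x) (Ici 0))
    (hTbdd : ∃ M : ℝ, ∀ t : ℝ, 0 ≤ t → ‖T t‖ ≤ M)
    -- generator `A` with domain `D`
    (D : Submodule ℂ X) (A : X →ₗ[ℂ] X)
    (hgen : ∀ x ∈ D, HasDerivWithinAt (fun t => T t x) (A x) (Ici 0) 0)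
    (hdom : ∀ x : X, (∃ y : X, HasDerivWithinAt (fun t => T t x) y (Ici 0) 0) → x ∈ D)
    -- the resolvent set of `A`
    (resolventSet : Set ℂ)
    (hres : ∀ z : ℂ, z ∈ resolventSet ↔ ∃ R : X →L[ℂ] X,
      (∀ y : X, R y ∈ D) ∧ (∀ y : X, z • R y - A (R y) = y) ∧ ∀ x ∈ D, R (z • x - A x) = x)
    -- `σ(A) ∩ iℝ` is countable
    (hcount : Set.Countable {z : ℂ | z ∉ resolventSet ∧ z.re = 0})
    -- no eigenvalue of `A` on the imaginary axis
    (heig : ∀ z : ℂ, z.re = 0 → ∀ x ∈ D, A x = z • x → x = 0) :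
    ∀ x : X, Tendsto (fun t => T t x) atTop (𝓝 0) := by
  obtain ⟨M, hM⟩ := hTbdd
  have hM0 : 0 ≤ M := (norm_nonneg _).trans (hM 0 le_rfl)
  have heig' : ∀ z : ℂ, z.re = 0 → ∀ x : X,
      (∀ s : ℝ, 0 ≤ s → T s x = Complex.exp (z * s) • x) → x = 0 := by
    intro z hz x hx
    have h1 : HasDerivWithinAt (fun t => T t x) (z • x) (Ici 0) 0 := by
      have h2 : HasDerivAt (fun t : ℝ => z * (t : ℂ)) (z * 1) 0 :=
        (hasDerivAt_id (0 : ℝ)).ofReal_comp.const_mul z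
      have h3 := (h2.cexp.smul_const x).hasDerivWithinAt (s := Ici 0)
      refine (h3.congr (fun s hs => hx s hs) (hx 0 le_rfl)).congr_deriv ?_
      simp
    have hxD := hdom x ⟨_, h1⟩
    exact heig z hz x hxD
      ((uniqueDiffOn_Ici (0 : ℝ) 0 self_mem_Ici).eq_deriv _ (hgen x hxD) h1)
  by_contra! hcon
  obtain ⟨x, hx⟩ := hcon
  obtain ⟨ψ, hψM, hψ, hψ0⟩ := exists_complete_trajectory hTsemi hM hx
  refine hψ0 (ContinuousLinearMap.ext fun y =>
    apply_eq_zero_of_laplaceTransform_eq_zero hTcont hψM hψ (fun y => ?_) y)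
  have hc := continuous_trajectory hTcont hψ y
  have hb : ∀ s : ℝ, ‖ψ s y‖ ≤ M * ‖y‖ := fun s =>
    ((ψ s).le_opNorm y).trans (mul_le_mul_of_nonneg_right (hψM s) (norm_nonneg _))
  have hdiff := differentiableOn_carlemanTransform hc hb
  have key := eq_zero_of_countable_compl_regularSet (z := 1) (by positivity) hdiff
    (fun z hz => norm_carlemanTransform_mul_le hb hz) ?_ ?_ (by simp)
  · simpa [carlemanTransform] using key
  · refine hcount.mono ?_
    intro z hz
    refine ⟨fun hzr => hz ?_, ?_⟩
    · obtain ⟨R, hRD, hR, -⟩ := (hres z).1 hzr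
      exact mem_regularSet_carlemanTransform hT0 hTcont hgen hψM hψ hRD hR y
    · by_contra h0
      exact hz (mem_regularSet_of_re_ne_zero hdiff h0)
  · intro z hz c hlim
    refine abel_mean_eq_zero hrefl hTsemi hTcont hM hz (heig' z hz) (ψ 0) y (hlim.congr' ?_)
    filter_upwards [self_mem_nhdsWithin] with a ha
    have ha' : 0 < (z + a).re := by simpa [hz] using ha
    rw [carlemanTransform, if_pos ha']
    congr 1
    refine laplaceTransform_congr (fun t ht => ?_) _
    rw [← zero_add t, hψ 0 t ht.le, zero_add]
    rfl
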